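/- arXiv:2601.06934 — 3 statements merged into one kernel-verified Lean document; each statement's English description precedes it below -/
import Mathlib

section
/- Let G₁ be a group and H, K finite subgroups of G₁, and suppose (ψ,g₁) is swapping data for (H,K). Then the permutation ι_{ψ,g₁} normalizes Γ̃_{HK} in Sym(Iso(H,K)), i.e., ι_{ψ,g₁}·σ·ι_{ψ,g₁}⁻¹ ∈ Γ̃_{HK} for every σ ∈ Γ̃_{HK}; consequently the set of products Γ̃_{HK}·⟨ι_{ψ,g₁}⟩ is a subgroup of Sym(Iso(H,K)). -/
universe u w

/-- The restriction to a subgroup `H` of an automorphism of `G` that leaves `H`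
invariant. -/
def restrAut {G : Type u} [Group G] (H : Subgroup G) (α : G ≃* G)
    (hα : ∀ x : G, x ∈ H ↔ α x ∈ H) : H ≃* H where
  toFun x := ⟨α x, (hα x).mp x.2⟩
  invFun x := ⟨α.symm x, (hα _).mpr (by simp)⟩
  left_inv x := by ext; simp
  right_inv x := by ext; simp
  map_mul' x y := by ext; simp

/-- The automorphism `x ↦ g·α(x)·g⁻¹` of a subgroup `K` invariant under it. -/
def conjAut {G : Type u} [Group G] (K : Subgroup G) (g : G) (α : G ≃* G)
    (hK : ∀ x : G, x ∈ K ↔ g * α x * g⁻¹ ∈ K) : K ≃* K where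
  toFun x := ⟨g * α x * g⁻¹, (hK x).mp x.2⟩
  invFun x := ⟨α.symm (g⁻¹ * x * g), (hK _).mpr (by simp [mul_assoc])⟩
  left_inv x := by ext; simp [mul_assoc]
  right_inv x := by ext; simp [mul_assoc]
  map_mul' x y := by ext; simp [mul_assoc]

/-- The permutation of `Iso(H,K)` induced by an element `(g,α)` of `Γ_{HK}`, i.e. a pair
with `α(H) = H` and `g·α(K)·g⁻¹ = K`.  It sends `f` to `h ↦ g·α(f(α⁻¹(h)))·g⁻¹`. -/
def gammaPerm {G : Type u} [Group G] (H K : Subgroup G) (g : G) (α : G ≃* G)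
    (hα : ∀ x : G, x ∈ H ↔ α x ∈ H)
    (hK : ∀ x : G, x ∈ K ↔ g * α x * g⁻¹ ∈ K) : Equiv.Perm (H ≃* K) where
  toFun f := ((restrAut H α hα).symm.trans f).trans (conjAut K g α hK)
  invFun f := ((restrAut H α hα).trans f).trans (conjAut K g α hK).symm
  left_inv f := by ext x; simp
  right_inv f := by ext x; simp

/-- `Γ̃_{HK}`: the image in `Sym(Iso(H,K))` of the stabilizer `Γ_{HK}`, i.e. the set of the
permutations `gammaPerm` induced by pairs `(g,α)` with `α(H) = H` and `g·α(K)·g⁻¹ = K`. -/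
def gammaTildeSet {G : Type u} [Group G] (H K : Subgroup G) : Set (Equiv.Perm (H ≃* K)) :=
  {σ | ∃ (g : G) (α : G ≃* G) (hα : ∀ x : G, x ∈ H ↔ α x ∈ H)
      (hK : ∀ x : G, x ∈ K ↔ g * α x * g⁻¹ ∈ K), σ = gammaPerm H K g α hα hK}

/-- The isomorphism `H ≃ K` obtained by restricting an automorphism `ψ` of `G` with
`ψ(H) = K`. -/
def restrMap {G : Type u} [Group G] (H K : Subgroup G) (ψ : G ≃* G)
    (h1 : ∀ x : G, x ∈ H ↔ ψ x ∈ K) : H ≃* K where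
  toFun x := ⟨ψ x, (h1 x).mp x.2⟩
  invFun y := ⟨ψ.symm y, (h1 _).mpr (by simp)⟩
  left_inv x := by ext; simp
  right_inv y := by ext; simp
  map_mul' x y := by ext; simp

/-- The isomorphism `H ≃ K`, `x ↦ ψ⁻¹(g₁⁻¹·x·g₁)`, coming from swapping data `(ψ,g₁)`
(where `ψ(K) = g₁⁻¹·H·g₁`, i.e. `∀ x, x ∈ K ↔ g₁·ψ(x)·g₁⁻¹ ∈ H`). -/
def dMap {G : Type u} [Group G] (H K : Subgroup G) (ψ : G ≃* G) (g₁ : G)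
    (h2 : ∀ x : G, x ∈ K ↔ g₁ * ψ x * g₁⁻¹ ∈ H) : H ≃* K where
  toFun x := ⟨ψ.symm (g₁⁻¹ * x * g₁), (h2 _).mpr (by simp [mul_assoc])⟩
  invFun y := ⟨g₁ * ψ y * g₁⁻¹, (h2 _).mp y.2⟩
  left_inv x := by ext; simp [mul_assoc]
  right_inv y := by ext; simp [mul_assoc]
  map_mul' x y := by ext; simp [mul_assoc]

/-- The permutation `ι_{ψ,g₁}` of `Iso(H,K)` attached to swapping data `(ψ,g₁)` for `(H,K)`
(i.e. `ψ(H) = K` and `ψ(K) = g₁⁻¹·H·g₁`): it sends `f` to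
`h ↦ ψ⁻¹(g₁⁻¹·f⁻¹(ψ(h))·g₁)`. -/
def iotaPerm {G : Type u} [Group G] (H K : Subgroup G) (ψ : G ≃* G) (g₁ : G)
    (h1 : ∀ x : G, x ∈ H ↔ ψ x ∈ K)
    (h2 : ∀ x : G, x ∈ K ↔ g₁ * ψ x * g₁⁻¹ ∈ H) : Equiv.Perm (H ≃* K) where
  toFun f := ((restrMap H K ψ h1).trans f.symm).trans (dMap H K ψ g₁ h2)
  invFun f := ((dMap H K ψ g₁ h2).trans f.symm).trans (restrMap H K ψ h1)
  left_inv f := by ext x; simp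
  right_inv f := by ext x; simp

/-- `Γ̃_{HK}` as a subgroup of `Sym(Iso(H,K))`. -/
def gammaTilde {G : Type u} [Group G] (H K : Subgroup G) : Subgroup (Equiv.Perm (H ≃* K)) where
  carrier := gammaTildeSet H K
  one_mem' := by
    refine ⟨1, MulEquiv.refl G, by simp, by simp, ?_⟩
    ext f x
    simp [gammaPerm, restrAut, conjAut]
  mul_mem' := by
    rintro _ _ ⟨g, α, hα, hK, rfl⟩ ⟨g', α', hα', hK', rfl⟩
    refine ⟨g * α g', α'.trans α, fun x => (hα' x).trans (hα _), fun x => ?_, ?_⟩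
    · rw [hK' x, hK]
      simp [mul_assoc]
    · ext f x
      simp [gammaPerm, restrAut, conjAut, mul_assoc]
  inv_mem' := by
    rintro _ ⟨g, α, hα, hK, rfl⟩
    refine ⟨α.symm g⁻¹, α.symm, fun x => ?_, fun x => ?_, ?_⟩
    · simpa using (hα (α.symm x)).symm
    · rw [hK (α.symm g⁻¹ * α.symm x * (α.symm g⁻¹)⁻¹)]
      simp [mul_assoc]
    · rw [inv_eq_iff_mul_eq_one]
      ext f x
      simp [gammaPerm, restrAut, conjAut, mul_assoc]

theorem iotaPerm_conj_mem_gammaTildeSet {G : Type u} [Group G] (H K : Subgroup G)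
    (ψ : G ≃* G) (g₁ : G) (h1 : ∀ x : G, x ∈ H ↔ ψ x ∈ K)
    (h2 : ∀ x : G, x ∈ K ↔ g₁ * ψ x * g₁⁻¹ ∈ H) {σ : Equiv.Perm (H ≃* K)}
    (hσ : σ ∈ gammaTildeSet H K) :
    iotaPerm H K ψ g₁ h1 h2 * σ * (iotaPerm H K ψ g₁ h1 h2)⁻¹ ∈ gammaTildeSet H K := by
  obtain ⟨g, α, hα, hK, rfl⟩ := hσ
  refine ⟨ψ.symm (g₁⁻¹ * α g₁ * g⁻¹),
    ((ψ.trans α).trans (MulAut.conj g)).trans ψ.symm, fun x => ?_, fun x => ?_, ?_⟩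
  · rw [h1 x, hK, h1]
    simp
  · rw [h2 x, hα, h2]
    simp [mul_assoc]
  · rw [mul_inv_eq_iff_eq_mul]
    ext f x
    simp [iotaPerm, gammaPerm, restrAut, conjAut, restrMap, dMap, mul_assoc]

/-- If `(ψ,g₁)` is swapping data for `(H,K)`, then `ι_{ψ,g₁}` normalizes `Γ̃_{HK}` in
`Sym(Iso(H,K))`; consequently the set of products `Γ̃_{HK}·⟨ι_{ψ,g₁}⟩` is a subgroup of
`Sym(Iso(H,K))`. -/
theorem iota_normalizes_gammaTilde {G₁ : Type u} [Group G₁] (H K : Subgroup G₁)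
    [Finite H] [Finite K] (ψ : G₁ ≃* G₁) (g₁ : G₁)
    (h1 : ∀ x : G₁, x ∈ H ↔ ψ x ∈ K)
    (h2 : ∀ x : G₁, x ∈ K ↔ g₁ * ψ x * g₁⁻¹ ∈ H) :
    (∀ σ ∈ gammaTildeSet H K,
        iotaPerm H K ψ g₁ h1 h2 * σ * (iotaPerm H K ψ g₁ h1 h2)⁻¹ ∈ gammaTildeSet H K) ∧
    ∃ Γ : Subgroup (Equiv.Perm (H ≃* K)),
      (Γ : Set (Equiv.Perm (H ≃* K))) =
        {x | ∃ σ ∈ gammaTildeSet H K, ∃ n : ℤ, x = σ * iotaPerm H K ψ g₁ h1 h2 ^ n} := by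
  have hconj := fun σ hσ => iotaPerm_conj_mem_gammaTildeSet H K ψ g₁ h1 h2 (σ := σ) hσ
  refine ⟨hconj, gammaTilde H K ⊔ Subgroup.zpowers (iotaPerm H K ψ g₁ h1 h2), ?_⟩
  have : Finite (H ≃* K) := Finite.of_injective _ DFunLike.coe_injective
  have hnorm : Subgroup.zpowers (iotaPerm H K ψ g₁ h1 h2) ≤
      Subgroup.normalizer (gammaTilde H K) :=
    Subgroup.zpowers_le.mpr (Subgroup.mem_normalizer_fintype hconj)
  rw [Subgroup.coe_mul_of_right_le_normalizer_left _ _ hnorm]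
  ext x
  simp [Set.mem_mul, Subgroup.mem_zpowers_iff, eq_comm]
  rfl
end

section
/- Let G₁ be a group, H and K subgroups of G₁, g₁ ∈ G₁ an element with g₁⁻¹·H·g₁ = K, and f : H → K an isomorphism. Let u ∈ Aut(H) be the automorphism u(h) = g₁·f(h)·g₁⁻¹. Then HNN(G₁,H,K,f) is isomorphic to HNN(G₁,H,H,u), and also to HNN(G₁,H,H,u⁻¹). -/
universe u

namespace HNNExtension

/-- Twisting the isomorphism of associated subgroups by an inner automorphism of the base group
does not change the HNN-extension: the stable letter `t` is replaced by `g * t`. -/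
def equivOfConj {G : Type*} [Group G] {A B C : Subgroup G} (g : G) (φ : A ≃* B) (ψ : A ≃* C)
    (h : ∀ a : A, (ψ a : G) = g * (φ a : G) * g⁻¹) :
    HNNExtension G A B φ ≃* HNNExtension G A C ψ :=
  MonoidHom.toMulEquiv
    (lift of (of g⁻¹ * t) fun a => by
      rw [mul_assoc, t_mul_of, h]
      simp [mul_assoc])
    (lift of (of g * t) fun a => by
      rw [mul_assoc, t_mul_of, h]
      simp [mul_assoc])
    (hom_ext (by ext; simp) (by simp))
    (hom_ext (by ext; simp) (by simp))

/-- Inverting the isomorphism of associated subgroups does not change the HNN-extension: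
the stable letter `t` is replaced by `t⁻¹`. -/
def equivSymm {G : Type*} [Group G] {A B : Subgroup G} (φ : A ≃* B) :
    HNNExtension G A B φ ≃* HNNExtension G B A φ.symm :=
  MonoidHom.toMulEquiv
    (lift of t⁻¹ fun a => by
      rw [inv_t_mul_of, MulEquiv.symm_symm])
    (lift of t⁻¹ inv_t_mul_of)
    (hom_ext (by ext; simp) (by simp))
    (hom_ext (by ext; simp) (by simp))

end HNNExtension

/-- Let `G₁` be a group, `H`, `K` subgroups, `g₁ ∈ G₁` with `g₁⁻¹ · H · g₁ = K`, and
`f : H → K` an isomorphism.  Let `u ∈ Aut(H)` be the automorphism `u h = g₁ · f h · g₁⁻¹`.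
Then `HNN(G₁,H,K,f)` is isomorphic to `HNN(G₁,H,H,u)`, and also to `HNN(G₁,H,H,u⁻¹)`. -/
theorem hnn_iso_normal_hnn {G₁ : Type u} [Group G₁] (H K : Subgroup G₁) (g₁ : G₁)
    (hg : ∀ x : G₁, x ∈ K ↔ g₁ * x * g₁⁻¹ ∈ H)  -- `g₁⁻¹ · H · g₁ = K`
    (f : H ≃* K) (u : H ≃* H)
    (hu : ∀ h : H, (u h : G₁) = g₁ * (f h : G₁) * g₁⁻¹) :
    Nonempty (HNNExtension G₁ H K f ≃* HNNExtension G₁ H H u) ∧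
    Nonempty (HNNExtension G₁ H K f ≃* HNNExtension G₁ H H u.symm) := by
  have e := HNNExtension.equivOfConj g₁ f u hu
  exact ⟨⟨e⟩, ⟨e.trans (HNNExtension.equivSymm u)⟩⟩
end

section
/- Let G₁, G₂, G₃ be OE-groups, H₁ a finite subgroup of G₁, f₁ ∈ Aut(H₁), and G = HNN(G₁, H₁, H₁, f₁). Let H₂ be a finite group with injective homomorphisms j₂ : H₂ → G₂ and j₃ : H₂ → G₃, and let B = G₂ *_{H₂} G₃ be the corresponding amalgamated free product (the pushout of j₂ and j₃). Then G and B are not isomorphic. -/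
universe u w

/-- A group has the tree fixed-point property if every action of it without inversions
(given by a homomorphism to the permutations of the vertices preserving adjacency) on a
tree (a nonempty connected acyclic simple graph) in which all edge stabilizers are finite
fixes a vertex. -/
def TreeFixedPointProperty (Γ : Type*) [Group Γ] : Prop :=
  ∀ (V : Type w) (T : SimpleGraph V), T.IsTree →
    ∀ ρ : Γ →* Equiv.Perm V,
      (∀ (g : Γ) (x y : V), T.Adj x y → T.Adj (ρ g x) (ρ g y)) →
      (¬ ∃ (g : Γ) (x y : V), T.Adj x y ∧ ρ g x = y ∧ ρ g y = x) →
      (∀ x y : V, T.Adj x y → Set.Finite {g : Γ | ρ g x = x ∧ ρ g y = y}) →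
      ∃ v : V, ∀ g : Γ, ρ g v = v

/-- A group is residually finite if every nontrivial element is nontrivial in some finite
quotient. -/
def ResiduallyFinite (G : Type*) [Group G] : Prop :=
  ∀ g : G, g ≠ 1 → ∃ (Q : Type) (_ : Group Q), Finite Q ∧ ∃ φ : G →* Q, φ g ≠ 1

/-- An OE-group: a finitely generated, residually finite group with the tree fixed-point
property. -/
def IsOEGroup (Γ : Type*) [Group Γ] : Prop :=
  Group.FG Γ ∧ ResiduallyFinite Γ ∧ TreeFixedPointProperty.{w} Γ

instance amalgGroupFam {G₂ G₃ : Type u} [Group G₂] [Group G₃] :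
    ∀ b : Bool, Group (Bool.rec G₃ G₂ b : Type u) := fun b => by
  cases b <;> dsimp <;> infer_instance

/-- The pair of homomorphisms defining an amalgamated free product. -/
def amalgMaps {P G₂ G₃ : Type u} [Group P] [Group G₂] [Group G₃]
    (j₂ : P →* G₂) (j₃ : P →* G₃) :
    ∀ b : Bool, P →* (Bool.rec G₃ G₂ b : Type u) := fun b =>
  Bool.rec (motive := fun b => P →* (Bool.rec G₃ G₂ b : Type u)) j₃ j₂ b

/-- The amalgamated free product `G₂ *_P G₃`: the pushout of the homomorphisms
`j₂ : P → G₂` and `j₃ : P → G₃` in the category of groups. -/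
def AmalgProd {P G₂ G₃ : Type u} [Group P] [Group G₂] [Group G₃]
    (j₂ : P →* G₂) (j₃ : P →* G₃) : Type u :=
  Monoid.PushoutI (amalgMaps j₂ j₃)

noncomputable instance {P G₂ G₃ : Type u} [Group P] [Group G₂] [Group G₃]
    (j₂ : P →* G₂) (j₃ : P →* G₃) : Group (AmalgProd j₂ j₃) := by
  unfold AmalgProd; infer_instance

/-- The canonical map from the left factor into the amalgamated free product. -/
def AmalgProd.inl {P G₂ G₃ : Type u} [Group P] [Group G₂] [Group G₃]
    (j₂ : P →* G₂) (j₃ : P →* G₃) : G₂ →* AmalgProd j₂ j₃ :=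
  Monoid.PushoutI.of (φ := amalgMaps j₂ j₃) true

/-- The canonical map from the right factor into the amalgamated free product. -/
def AmalgProd.inr {P G₂ G₃ : Type u} [Group P] [Group G₂] [Group G₃]
    (j₂ : P →* G₂) (j₃ : P →* G₃) : G₃ →* AmalgProd j₂ j₃ :=
  Monoid.PushoutI.of (φ := amalgMaps j₂ j₃) false

/-- A graph whose vertices are labelled injectively by lists is a tree if its edges join each
vertex with nonempty label to the vertex labelled by the tail. -/
theorem SimpleGraph.isTree_of_list_label {V α : Type*} [Nonempty V] (T : SimpleGraph V)
    (L : V → List α) (hL : Function.Injective L)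
    (hparent : ∀ v p l, L v = p :: l → ∃ w, T.Adj v w ∧ L w = l)
    (hadj : ∀ v w, T.Adj v w → (∃ p, L v = p :: L w) ∨ ∃ p, L w = p :: L v) :
    T.IsTree := by
  have hroot : ∀ (l : List α) (v : V), L v = l → ∃ r, L r = [] ∧ T.Reachable v r := by
    intro l
    induction l with
    | nil => exact fun v hv => ⟨v, hv, .refl v⟩
    | cons p l ih =>
      intro v hv
      obtain ⟨w, hvw, hw⟩ := hparent v p l hv
      obtain ⟨r, hr, hwr⟩ := ih w hw
      exact ⟨r, hr, hvw.reachable.trans hwr⟩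
  have hbridge : ∀ v w, (∃ p, L v = p :: L w) → ¬ (T.deleteEdges {s(v, w)}).Reachable v w := by
    rintro v w ⟨p, hp⟩ ⟨q⟩
    have hdesc : ∀ x y, (T.deleteEdges {s(v, w)}).Adj x y → L v <:+ L x → L v <:+ L y := by
      intro x y hxy hx
      rw [SimpleGraph.deleteEdges_adj] at hxy
      rcases hadj x y hxy.1 with ⟨c, hc⟩ | ⟨c, hc⟩
      · rw [hc, List.suffix_cons_iff] at hx
        rcases hx with hx | hx
        · have hxv : x = v := hL (hc.trans hx.symm)
          have hyw : y = w := hL (by rw [hx] at hp; exact (List.cons.inj hp).2)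
          exact absurd (by simp [hxv, hyw]) hxy.2
        · exact hx
      · rw [hc]
        exact hx.trans (List.suffix_cons _ _)
    have hwalk : ∀ {x y} (_ : (T.deleteEdges {s(v, w)}).Walk x y), L v <:+ L x → L v <:+ L y := by
      intro x y q
      induction q with
      | nil => exact id
      | cons h _ ih => exact fun hx => ih (hdesc _ _ h hx)
    have := (hwalk q List.suffix_rfl).length_le
    simp [hp] at this
  refine ⟨⟨fun v w => ?_⟩, ?_⟩
  · obtain ⟨r, hr, hvr⟩ := hroot _ v rfl
    obtain ⟨r', hr', hwr⟩ := hroot _ w rfl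
    obtain rfl : r = r' := hL (hr.trans hr'.symm)
    exact hvr.trans hwr.symm
  · rw [SimpleGraph.isAcyclic_iff_forall_adj_isBridge]
    intro v w hvw
    rw [SimpleGraph.isBridge_iff]
    rcases hadj v w hvw with h | h
    · exact hbridge v w h
    · rw [Sym2.eq_swap, SimpleGraph.reachable_comm]
      exact hbridge w v h

namespace HNNExtension

variable {G : Type*} [Group G] {A B : Subgroup G} {φ : A ≃* B}

/-- The homomorphism to `ℤ` killing the base group and sending the stable letter to `1`. -/
def exponent : HNNExtension G A B φ →* Multiplicative ℤ :=
  lift 1 (Multiplicative.ofAdd 1) (by simp)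

@[simp]
theorem exponent_of (g : G) : exponent (of g : HNNExtension G A B φ) = 1 := by
  simp [exponent]

@[simp]
theorem exponent_t : exponent (t : HNNExtension G A B φ) = Multiplicative.ofAdd 1 := by
  simp [exponent]

theorem exponent_eq_one_of_mem_range {x : HNNExtension G A B φ}
    (hx : x ∈ (of : G →* HNNExtension G A B φ).range) : exponent x = 1 := by
  obtain ⟨g, rfl⟩ := hx
  exact exponent_of g

theorem exponent_t_zpow (n : ℤ) :
    exponent (t ^ n : HNNExtension G A B φ) = Multiplicative.ofAdd n := by
  rw [map_zpow, exponent_t, ← ofAdd_zsmul, smul_eq_mul, mul_one]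

theorem t_zpow_units_notMem_range (u : ℤˣ) :
    (t ^ (u : ℤ) : HNNExtension G A B φ) ∉ (of : G →* HNNExtension G A B φ).range := fun h =>
  u.ne_zero (ofAdd_eq_one.mp ((exponent_t_zpow (u : ℤ)).symm.trans
    (exponent_eq_one_of_mem_range h)))

variable (φ) in
/-- The vertices of the Bass-Serre tree: the left cosets of the base group. -/
abbrev Vertex : Type _ :=
  HNNExtension G A B φ ⧸ (of : G →* HNNExtension G A B φ).range

variable (φ) in
/-- The Bass-Serre tree of an HNN extension. -/
def bassSerreTree : SimpleGraph (Vertex φ) where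
  Adj v w := ∃ (g : HNNExtension G A B φ) (u : ℤˣ),
    v = (g : Vertex φ) ∧ w = ((g * t ^ (u : ℤ) : HNNExtension G A B φ) : Vertex φ)
  symm := ⟨by
    rintro _ _ ⟨g, u, rfl, rfl⟩
    exact ⟨g * t ^ (u : ℤ), -u, rfl, by simp⟩⟩
  loopless := ⟨by
    rintro _ ⟨g, u, rfl, h⟩
    rw [QuotientGroup.eq, inv_mul_cancel_left] at h
    exact t_zpow_units_notMem_range u h⟩

theorem bassSerreTree_adj_smul (x : HNNExtension G A B φ) {v w : Vertex φ}
    (h : (bassSerreTree φ).Adj v w) : (bassSerreTree φ).Adj (x • v) (x • w) := by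
  obtain ⟨g, u, rfl, rfl⟩ := h
  exact ⟨x * g, u, rfl, by rw [mul_assoc]; rfl⟩

theorem smul_coe_eq_coe_iff (x g h : HNNExtension G A B φ) :
    x • (g : Vertex φ) = h ↔ h⁻¹ * x * g ∈ (of : G →* HNNExtension G A B φ).range := by
  rw [mul_assoc, ← QuotientGroup.eq, eq_comm]
  rfl

theorem exponent_eq_one_of_smul_eq {x : HNNExtension G A B φ} {v : Vertex φ}
    (h : x • v = v) : exponent x = 1 := by
  induction v using QuotientGroup.induction_on with
  | H g =>
    rw [smul_coe_eq_coe_iff] at h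
    simpa using exponent_eq_one_of_mem_range h

theorem bassSerreTree_no_inversion (x : HNNExtension G A B φ) {v w : Vertex φ}
    (hvw : (bassSerreTree φ).Adj v w) (h₁ : x • v = w) (h₂ : x • w = v) : False := by
  obtain ⟨g, u, rfl, rfl⟩ := hvw
  rw [smul_coe_eq_coe_iff] at h₁ h₂
  have e₁ := congrArg Multiplicative.toAdd (exponent_eq_one_of_mem_range h₁)
  have e₂ := congrArg Multiplicative.toAdd (exponent_eq_one_of_mem_range h₂)
  have hu := u.ne_zero
  simp only [map_mul, map_inv, exponent_t_zpow, toAdd_mul, toAdd_inv, toAdd_ofAdd,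
    toAdd_one] at e₁ e₂
  omega

theorem mem_toSubgroup_of_conj_mem_range {a : G} {u : ℤˣ}
    (h : (t ^ (u : ℤ) * of a * t ^ (-u : ℤ) : HNNExtension G A B φ) ∈
      (of : G →* HNNExtension G A B φ).range) : a ∈ toSubgroup A B u := by
  by_contra ha
  let w : NormalWord.ReducedWord G A B :=
    { head := 1
      toList := [(u, a), (-u, 1)]
      chain := by simp [ha] }
  have := ReducedWord.toList_eq_nil_of_mem_of_range φ w
    (by simpa [NormalWord.ReducedWord.prod, w, mul_assoc] using h)
  simp [w] at this

theorem finite_edge_stabilizer [Finite A] {v w : Vertex φ} (hvw : (bassSerreTree φ).Adj v w) :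
    {x : HNNExtension G A B φ | x • v = v ∧ x • w = w}.Finite := by
  obtain ⟨g, u, rfl, rfl⟩ := hvw
  have : Finite B := Finite.of_equiv A φ.toEquiv
  have hfin : (toSubgroup A B (-u) : Set G).Finite := by
    rcases Int.units_eq_one_or u with rfl | rfl
    · exact Set.toFinite (B : Set G)
    · exact Set.toFinite (A : Set G)
  refine (hfin.image fun a => g * of a * g⁻¹).subset ?_
  rintro x ⟨h₁, h₂⟩
  rw [smul_coe_eq_coe_iff] at h₁ h₂
  obtain ⟨a, ha⟩ := h₁
  have hx : x = g * of a * g⁻¹ := by rw [ha]; group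
  refine ⟨a, mem_toSubgroup_of_conj_mem_range (φ := φ) ?_, hx.symm⟩
  rw [hx] at h₂
  simpa [mul_assoc] using h₂

section Label

open NormalWord

variable {d : TransversalPair G A B}

theorem NormalWord.unitsSMul_toList (u : ℤˣ) (w : NormalWord d) :
    (∃ p, (unitsSMul φ u w).toList = p :: w.toList) ∨
      ∃ p, w.toList = p :: (unitsSMul φ u w).toList := by
  unfold unitsSMul
  split_ifs with h
  · right
    induction w using consRecOn with
    | ofGroup => simp [Cancels] at h
    | cons g u' w h₁ h₂ _ =>
      refine ⟨(u', w.head), ?_⟩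
      simp [unitsSMulWithCancel]
  · left
    simp

theorem NormalWord.exists_eq_cons {w : NormalWord d} {p : ℤˣ × G} {l : List (ℤˣ × G)}
    (h : w.toList = p :: l) : ∃ (a : G) (u : ℤˣ) (w' : NormalWord d),
      w'.toList = l ∧ w.prod φ = of a * (t ^ (u : ℤ) * w'.prod φ) := by
  cases w using consRecOn with
  | ofGroup => simp at h
  | cons g u w h₁ h₂ =>
    exact ⟨g, u, w, (List.cons.inj h).2, prod_cons φ g u w h₁ h₂⟩

variable (φ d) in
/-- The label of a coset `g G`: the normal form of `g⁻¹` without its head. -/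
noncomputable def label : Vertex φ → List (ℤˣ × G) :=
  Quotient.lift (fun g => (g⁻¹ • (empty : NormalWord d)).toList) (by
    intro g h hgh
    obtain ⟨a, ha⟩ := QuotientGroup.leftRel_apply.mp hgh
    obtain rfl : h = g * of a := by rw [ha]; group
    rw [mul_inv_rev, mul_smul, ← map_inv, of_smul_eq_smul, group_smul_toList])

theorem label_coe (g : HNNExtension G A B φ) :
    label φ d (g : Vertex φ) = (g⁻¹ • (empty : NormalWord d)).toList := rfl

theorem label_injective : Function.Injective (label φ d) := by
  intro v w
  induction v using QuotientGroup.induction_on with | H g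
  induction w using QuotientGroup.induction_on with | H h
  intro hgh
  rw [label_coe, label_coe] at hgh
  rw [QuotientGroup.eq]
  set W := g⁻¹ • (empty : NormalWord d) with hW
  set W' := h⁻¹ • (empty : NormalWord d) with hW'
  have hWW' : W = (W.head * W'.head⁻¹) • W' := NormalWord.ext (by simp) (by simpa using hgh)
  have := congrArg (fun w : NormalWord d => w.prod φ) hWW'
  rw [prod_group_smul, hW, hW', prod_smul, prod_smul, prod_empty, mul_one, mul_one] at this
  exact ⟨W.head * W'.head⁻¹, by rw [this, inv_mul_cancel_right]⟩

theorem exists_adj_of_label_eq_cons (v : Vertex φ) (p : ℤˣ × G) (l : List (ℤˣ × G))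
    (hv : label φ d v = p :: l) : ∃ w, (bassSerreTree φ).Adj v w ∧ label φ d w = l := by
  induction v using QuotientGroup.induction_on with | H g
  obtain ⟨a, u, w, hw, hprod⟩ := exists_eq_cons (φ := φ) hv
  rw [prod_smul, prod_empty, mul_one] at hprod
  refine ⟨(((w.prod φ)⁻¹ : HNNExtension G A B φ) : Vertex φ), ?_, ?_⟩
  · refine SimpleGraph.Adj.symm ⟨(w.prod φ)⁻¹, -u, rfl, ?_⟩
    rw [QuotientGroup.eq, hprod]
    exact ⟨a, by simp [mul_assoc]⟩
  · rw [label_coe, inv_inv, prod_smul_empty, hw]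

theorem label_of_adj (v w : Vertex φ) (h : (bassSerreTree φ).Adj v w) :
    (∃ p, label φ d v = p :: label φ d w) ∨ ∃ p, label φ d w = p :: label φ d v := by
  obtain ⟨g, u, rfl, rfl⟩ := h
  rw [label_coe, label_coe, mul_inv_rev, mul_smul, ← zpow_neg, ← Units.val_neg,
    t_pow_smul_eq_unitsSMul]
  exact (unitsSMul_toList _ _).symm

end Label

variable (φ) in
theorem bassSerreTree_isTree : (bassSerreTree φ).IsTree := by
  obtain ⟨d⟩ := NormalWord.TransversalPair.nonempty G A B
  exact SimpleGraph.isTree_of_list_label _ (label φ d) label_injective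
    exists_adj_of_label_eq_cons label_of_adj

variable (φ) in
theorem countable_vertex [Countable G] : Countable (Vertex φ) := by
  obtain ⟨d⟩ := NormalWord.TransversalPair.nonempty G A B
  exact (label_injective (φ := φ) (d := d)).countable

end HNNExtension

/-- The tree fixed-point property for trees of any universe with a small vertex set. -/
theorem TreeFixedPointProperty.exists_fixed {Γ : Type*} [Group Γ]
    (h : TreeFixedPointProperty.{w} Γ) {V : Type*} [Small.{w} V] {T : SimpleGraph V}
    (hT : T.IsTree) (ρ : Γ →* Equiv.Perm V)
    (hadj : ∀ (g : Γ) (x y : V), T.Adj x y → T.Adj (ρ g x) (ρ g y))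
    (hinv : ¬ ∃ (g : Γ) (x y : V), T.Adj x y ∧ ρ g x = y ∧ ρ g y = x)
    (hfin : ∀ x y : V, T.Adj x y → Set.Finite {g : Γ | ρ g x = x ∧ ρ g y = y}) :
    ∃ v : V, ∀ g : Γ, ρ g v = v := by
  let e : Shrink.{w} V ≃ V := (equivShrink V).symm
  obtain ⟨v, hv⟩ := h (Shrink.{w} V) (T.comap e)
    ((SimpleGraph.Iso.comap e T).isTree_iff.mpr hT)
    (e.symm.permCongrHom.toMonoidHom.comp ρ)
    (fun g x y hxy => by simpa using hadj g _ _ hxy)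
    (by
      rintro ⟨g, x, y, hxy, h₁, h₂⟩
      refine hinv ⟨g, e x, e y, hxy, ?_, ?_⟩
      · simpa [Equiv.symm_apply_eq] using h₁
      · simpa [Equiv.symm_apply_eq] using h₂)
    (fun x y hxy => by simpa [Equiv.symm_apply_eq] using hfin _ _ hxy)
  exact ⟨e v, fun g => by simpa [Equiv.symm_apply_eq] using hv g⟩

/-- A group with the tree fixed-point property embedded into an HNN extension with finite
associated subgroups is killed by the exponent homomorphism. -/
theorem TreeFixedPointProperty.exponent_eq_one {Γ G : Type*} [Group Γ] [Group G] [Countable G]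
    (h : TreeFixedPointProperty.{w} Γ) {A B : Subgroup G} [Finite A] {φ : A ≃* B}
    {f : Γ →* HNNExtension G A B φ} (hf : Function.Injective f) (g : Γ) :
    HNNExtension.exponent (f g) = 1 := by
  have := HNNExtension.countable_vertex φ
  obtain ⟨v, hv⟩ := h.exists_fixed (HNNExtension.bassSerreTree_isTree φ)
    ((MulAction.toPermHom (HNNExtension G A B φ) (HNNExtension.Vertex φ)).comp f)
    (fun g _ _ hxy => HNNExtension.bassSerreTree_adj_smul (f g) hxy)
    (fun ⟨g, _, _, hxy, h₁, h₂⟩ => HNNExtension.bassSerreTree_no_inversion (f g) hxy h₁ h₂)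
    (fun _ _ hxy => (HNNExtension.finite_edge_stabilizer hxy).preimage hf.injOn)
  exact HNNExtension.exponent_eq_one_of_smul_eq (hv g)

theorem Group.FG.countable {G : Type*} [Group G] (h : Group.FG G) : Countable G := by
  obtain ⟨S, hS, f, hf⟩ := Group.fg_iff_exists_freeGroup_hom_surjective.mp h
  have := hS.countable.to_subtype
  exact hf.countable

section AmalgProd

variable {P G₂ G₃ : Type u} [Group P] [Group G₂] [Group G₃] {j₂ : P →* G₂} {j₃ : P →* G₃}

theorem amalgMaps_injective (hj₂ : Function.Injective j₂) (hj₃ : Function.Injective j₃) :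
    ∀ b, Function.Injective (amalgMaps j₂ j₃ b)
  | true => hj₂
  | false => hj₃

theorem AmalgProd.inl_injective (hj₂ : Function.Injective j₂) (hj₃ : Function.Injective j₃) :
    Function.Injective (AmalgProd.inl j₂ j₃) :=
  Monoid.PushoutI.of_injective (amalgMaps_injective hj₂ hj₃) true

theorem AmalgProd.inr_injective (hj₂ : Function.Injective j₂) (hj₃ : Function.Injective j₃) :
    Function.Injective (AmalgProd.inr j₂ j₃) :=
  Monoid.PushoutI.of_injective (amalgMaps_injective hj₂ hj₃) false

theorem AmalgProd.hom_ext {K : Type*} [Group K] {f g : AmalgProd j₂ j₃ →* K}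
    (hl : f.comp (AmalgProd.inl j₂ j₃) = g.comp (AmalgProd.inl j₂ j₃))
    (hr : f.comp (AmalgProd.inr j₂ j₃) = g.comp (AmalgProd.inr j₂ j₃)) : f = g :=
  Monoid.PushoutI.hom_ext_nonempty (φ := amalgMaps j₂ j₃) fun
    | true => hl
    | false => hr

end AmalgProd

/-- An HNN-extension `HNN(G₁,H₁,H₁,f₁)` of an OE-group with finite associated subgroup
cannot be isomorphic to an amalgamated free product `G₂ *_{H₂} G₃` of OE-groups over a
finite group `H₂`. -/
theorem hnn_not_iso_amalgamated_product {G₁ G₂ G₃ : Type u}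
    [Group G₁] [Group G₂] [Group G₃]
    (hOE₁ : IsOEGroup.{w} G₁) (hOE₂ : IsOEGroup.{w} G₂) (hOE₃ : IsOEGroup.{w} G₃)
    (H₁ : Subgroup G₁) [Finite H₁] (f₁ : H₁ ≃* H₁)
    (H₂ : Type u) [Group H₂] [Finite H₂]
    (j₂ : H₂ →* G₂) (j₃ : H₂ →* G₃)
    (hj₂ : Function.Injective j₂) (hj₃ : Function.Injective j₃) :
    ¬ Nonempty (HNNExtension G₁ H₁ H₁ f₁ ≃* AmalgProd j₂ j₃) := by
  rintro ⟨ψ⟩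
  have := hOE₁.1.countable
  have hψ : Function.Injective ψ.symm.toMonoidHom := ψ.symm.injective
  have key : HNNExtension.exponent.comp ψ.symm.toMonoidHom = 1 :=
    AmalgProd.hom_ext
      (MonoidHom.ext (hOE₂.2.2.exponent_eq_one
        (f := ψ.symm.toMonoidHom.comp (AmalgProd.inl j₂ j₃))
        (hψ.comp (AmalgProd.inl_injective hj₂ hj₃))))
      (MonoidHom.ext (hOE₃.2.2.exponent_eq_one
        (f := ψ.symm.toMonoidHom.comp (AmalgProd.inr j₂ j₃))
        (hψ.comp (AmalgProd.inr_injective hj₂ hj₃))))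
  have ht := DFunLike.congr_fun key (ψ HNNExtension.t)
  simp at ht
end
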